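/- The projection K^56 → K^28 onto the 28 coordinates (η'_1, …, η'_7, μ'_{j,k} for 2 ≤ j < k ≤ 7, ν'_{1,l} for l = 2,…,7) restricts to a bijection from the set {x ∈ H_7 : η'_1 ≠ 0, …, η'_7 ≠ 0} onto the set of tuples in K^28 whose seven coordinates η'_1, …, η'_7 are all nonzero, the remaining 21 coordinates being arbitrary. -/

import Mathlib

/-- Index pairs `(i,j)` with `i < j` in `{1,…,8}` (0-based `Fin 8`). -/
abbrev P8 := {p : Fin 8 × Fin 8 // p.1 < p.2}

/-- The 56 coordinates: `x^{ij}` (left) and `y_{ij}` (right) for `i < j`. -/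
abbrev I56 := P8 ⊕ P8

variable {K : Type} [Field K]

/-- The antisymmetric extension `x^{ij}` (with `x^{ji} = −x^{ij}`, `x^{ii} = 0`). -/
def xc (z : I56 → K) (i j : Fin 8) : K :=
  if h : i < j then z (Sum.inl ⟨(i, j), h⟩)
  else if h : j < i then -z (Sum.inl ⟨(j, i), h⟩) else 0

/-- The antisymmetric extension `y_{ij}` (with `y_{ji} = −y_{ij}`, `y_{ii} = 0`). -/
def yc (z : I56 → K) (i j : Fin 8) : K :=
  if h : i < j then z (Sum.inr ⟨(i, j), h⟩)
  else if h : j < i then -z (Sum.inr ⟨(j, i), h⟩) else 0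

/-- The quadric `u^{ijkl}` for `i<j<k<l` with sorted complement `a<b<c<d`; the sign
`σ` of the shuffle permutation `(i,j,k,l,a,b,c,d)` equals `(−1)^{i+j+k+l}` (0-based). -/
def uEq (z : I56 → K) (i j k l a b c d : Fin 8) : K :=
  xc z i j * xc z k l - xc z i k * xc z j l + xc z i l * xc z j k +
    (-1 : K) ^ ((i : ℕ) + (j : ℕ) + (k : ℕ) + (l : ℕ)) *
      (yc z a b * yc z c d - yc z a c * yc z b d + yc z a d * yc z b c)

/-- The quadric `v^i_j = Σ_{k ∉ {i,j}} x^{ik} y_{kj}` for `i ≠ j`. -/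
def vEq (z : I56 → K) (i j : Fin 8) : K :=
  ∑ k ∈ Finset.univ \ {i, j}, xc z i k * yc z k j

/-- The quadric `v^i_i = −(3/4) Σ_{j≠i} x^{ij}y_{ij} + (1/4) Σ_{j<k, j,k≠i} x^{jk}y_{jk}`. -/
def vDiag (z : I56 → K) (i : Fin 8) : K :=
  -((3 / 4 : K) * (∑ j ∈ Finset.univ \ {i}, xc z i j * yc z i j))
    + (1 / 4 : K) * (∑ p ∈ Finset.univ.filter
        (fun p : Fin 8 × Fin 8 => p.1 < p.2 ∧ p.1 ≠ i ∧ p.2 ≠ i),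
        xc z p.1 p.2 * yc z p.1 p.2)

/-- Membership in the affine cone `H₇` over `G₇/P₇`: all equations
`u^{ijkl} = 0`, `v^i_j = 0` (`i ≠ j`) and `v^i_i = 0` hold. -/
def H7mem (z : I56 → K) : Prop :=
  (∀ i j k l a b c d : Fin 8, i < j → j < k → k < l → a < b → b < c → c < d →
      ({i, j, k, l, a, b, c, d} : Finset (Fin 8)) = Finset.univ →
      uEq z i j k l a b c d = 0) ∧
  (∀ i j : Fin 8, i ≠ j → vEq z i j = 0) ∧
  (∀ i : Fin 8, vDiag z i = 0)

/-- Index pairs `(j,k)` with `2 ≤ j < k ≤ 7` (0-based: `0 < j < k` in `Fin 7`). -/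
abbrev Q7 := {p : Fin 7 × Fin 7 // (0 : Fin 7) < p.1 ∧ p.1 < p.2}

/-- Indices `l` with `2 ≤ l ≤ 7` (0-based: `0 < l` in `Fin 7`). -/
abbrev L7 := {l : Fin 7 // (0 : Fin 7) < l}

/-- The projection of `K^56` onto the 28 coordinates
`(η'_1,…,η'_7, μ'_{j,k} (2 ≤ j < k ≤ 7), ν'_{1,l} (l = 2,…,7))`. -/
def proj28 (z : I56 → K) : (Fin 7 → K) × (Q7 → K) × (L7 → K) :=
  (fun i => xc z i.castSucc 7,
   fun q => yc z q.1.1.castSucc q.1.2.castSucc,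
   fun l => xc z 0 l.1.castSucc)

/-- The `4 × 4` Pfaffian of the antisymmetric matrix `y` on the indices `a, b, c, d`. -/
def yPf (z : I56 → K) (a b c d : Fin 8) : K :=
  yc z a b * yc z c d - yc z a c * yc z b d + yc z a d * yc z b c

/-- For `0 < i < j < 7`, the signed Pfaffian of `y` on the complement of `{0, i, j, 7}`. -/
def yPfCompl (z : I56 → K) : Fin 8 → Fin 8 → K :=
  !![0, 0, 0, 0, 0, 0, 0, 0;
     0, 0, -yPf z 3 4 5 6, yPf z 2 4 5 6, -yPf z 2 3 5 6, yPf z 2 3 4 6, -yPf z 2 3 4 5, 0;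
     0, 0, 0, -yPf z 1 4 5 6, yPf z 1 3 5 6, -yPf z 1 3 4 6, yPf z 1 3 4 5, 0;
     0, 0, 0, 0, -yPf z 1 2 5 6, yPf z 1 2 4 6, -yPf z 1 2 4 5, 0;
     0, 0, 0, 0, 0, -yPf z 1 2 3 6, yPf z 1 2 3 5, 0;
     0, 0, 0, 0, 0, 0, -yPf z 1 2 3 4, 0;
     0, 0, 0, 0, 0, 0, 0, 0;
     0, 0, 0, 0, 0, 0, 0, 0]

/-- The point of `H₇` with `x^{07} = 1` having the same coordinates `x^{0j}`, `x^{j7}` and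
`y_{jk}` (`0 < j, k < 7`) as `z`. -/
def bigCellPoint (z : I56 → K) : I56 → K
  | Sum.inl p =>
    if p.1 = (0, 7) then 1
    else if p.1.1 = 0 then xc z 0 p.1.2
    else if p.1.2 = 7 then xc z p.1.1 7
    else xc z p.1.1 7 * xc z 0 p.1.2 - xc z 0 p.1.1 * xc z p.1.2 7 + yPfCompl z p.1.1 p.1.2
  | Sum.inr p =>
    if p.1 = (0, 7) then
      (∑ k ∈ Finset.Ioo 0 7, ∑ l ∈ Finset.Ioo 0 7, xc z 0 k * xc z l 7 * yc z l k)
        + ∑ k ∈ Finset.Ioo 1 7, yc z 1 k * yPfCompl z 1 k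
    else if p.1.1 = 0 then ∑ k ∈ Finset.Ioo 0 7, xc z k 7 * yc z p.1.2 k
    else if p.1.2 = 7 then ∑ k ∈ Finset.Ioo 0 7, xc z 0 k * yc z k p.1.1
    else yc z p.1.1 p.1.2

@[simp]
theorem xc_self (z : I56 → K) (i : Fin 8) : xc z i i = 0 := by simp [xc]

@[simp]
theorem yc_self (z : I56 → K) (i : Fin 8) : yc z i i = 0 := by simp [yc]

theorem xc_swap (z : I56 → K) (i j : Fin 8) : xc z i j = -xc z j i := by
  rcases lt_trichotomy i j with h | rfl | h <;> simp [xc, *, not_lt_of_gt]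

theorem yc_swap (z : I56 → K) (i j : Fin 8) : yc z i j = -yc z j i := by
  rcases lt_trichotomy i j with h | rfl | h <;> simp [yc, *, not_lt_of_gt]

theorem xc_smul (c : K) (z : I56 → K) (i j : Fin 8) : xc (c • z) i j = c * xc z i j := by
  unfold xc; split_ifs <;> simp

theorem yc_smul (c : K) (z : I56 → K) (i j : Fin 8) : yc (c • z) i j = c * yc z i j := by
  unfold yc; split_ifs <;> simp

theorem vEq_eq_sum (z : I56 → K) (i j : Fin 8) : vEq z i j = ∑ k, xc z i k * yc z k j := by
  refine Finset.sum_subset (Finset.subset_univ _) fun k _ hk => ?_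
  obtain rfl | rfl : k = i ∨ k = j := by simpa [or_iff_not_imp_left] using hk
  · rw [xc_self, zero_mul]
  · rw [yc_self, mul_zero]

theorem H7mem.smul {z : I56 → K} (hz : H7mem z) (c : K) : H7mem (c • z) := by
  refine ⟨fun i j k l a b c' d h₁ h₂ h₃ h₄ h₅ h₆ h => ?_, fun i j h => ?_, fun i => ?_⟩
  · have := hz.1 i j k l a b c' d h₁ h₂ h₃ h₄ h₅ h₆ h
    simp only [uEq, xc_smul, yc_smul] at this ⊢
    linear_combination c ^ 2 * this
  · have := hz.2.1 i j h
    simp only [vEq, xc_smul, yc_smul, mul_mul_mul_comm c, ← Finset.mul_sum] at this ⊢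
    rw [this, mul_zero]
  · have := hz.2.2 i
    simp only [vDiag, xc_smul, yc_smul, mul_mul_mul_comm c, ← Finset.mul_sum] at this ⊢
    linear_combination c ^ 2 * this

theorem sum_Ioo_zero_seven (f : Fin 8 → K) :
    ∑ k ∈ Finset.Ioo 0 7, f k = f 1 + f 2 + f 3 + f 4 + f 5 + f 6 := by
  rw [show Finset.Ioo (0 : Fin 8) 7 = {1, 2, 3, 4, 5, 6} from rfl]
  simp [add_assoc]

theorem sum_Ioo_one_seven (f : Fin 8 → K) :
    ∑ k ∈ Finset.Ioo 1 7, f k = f 2 + f 3 + f 4 + f 5 + f 6 := by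
  rw [show Finset.Ioo (1 : Fin 8) 7 = {2, 3, 4, 5, 6} from rfl]
  simp [add_assoc]

theorem xc_of_gt (z : I56 → K) {i j : Fin 8} (_ : j < i) : xc z i j = -xc z j i := xc_swap z i j

theorem yc_of_gt (z : I56 → K) {i j : Fin 8} (_ : j < i) : yc z i j = -yc z j i := yc_swap z i j

@[simp]
theorem xc_bigCellPoint_zero_seven (z : I56 → K) : xc (bigCellPoint z) 0 7 = 1 := by
  simp [xc, bigCellPoint]

@[simp]
theorem xc_bigCellPoint_zero (z : I56 → K) {j : Fin 8} (hj : j < 7) :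
    xc (bigCellPoint z) 0 j = xc z 0 j := by
  rcases eq_or_ne 0 j with rfl | h
  · simp only [xc_self]
  · simp [xc, bigCellPoint, hj.ne, Fin.pos_iff_ne_zero.2 h.symm]

@[simp]
theorem xc_bigCellPoint_seven (z : I56 → K) {i : Fin 8} (hi : 0 < i) :
    xc (bigCellPoint z) i 7 = xc z i 7 := by
  rcases eq_or_ne i 7 with rfl | h
  · simp only [xc_self]
  · have : i < 7 := lt_of_le_of_ne (Fin.le_last i) h
    simp [xc, bigCellPoint, hi.ne', this]

@[simp]
theorem xc_bigCellPoint_of_lt (z : I56 → K) {i j : Fin 8} (hi : 0 < i) (hij : i < j) (hj : j < 7) :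
    xc (bigCellPoint z) i j = xc z i 7 * xc z 0 j - xc z 0 i * xc z j 7 + yPfCompl z i j := by
  rw [xc, dif_pos hij]
  simp [bigCellPoint, hi.ne', hj.ne]

@[simp]
theorem yc_bigCellPoint_zero_seven (z : I56 → K) : yc (bigCellPoint z) 0 7 =
    (∑ k ∈ Finset.Ioo 0 7, ∑ l ∈ Finset.Ioo 0 7, xc z 0 k * xc z l 7 * yc z l k)
      + ∑ k ∈ Finset.Ioo 1 7, yc z 1 k * yPfCompl z 1 k := by
  simp [yc, bigCellPoint]

@[simp]
theorem yc_bigCellPoint_zero (z : I56 → K) {j : Fin 8} (h : 0 < j) (hj : j < 7) :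
    yc (bigCellPoint z) 0 j = ∑ k ∈ Finset.Ioo 0 7, xc z k 7 * yc z j k := by
  rw [yc, dif_pos h]
  simp [bigCellPoint, hj.ne]

@[simp]
theorem yc_bigCellPoint_seven (z : I56 → K) {i : Fin 8} (hi : 0 < i) (h : i < 7) :
    yc (bigCellPoint z) i 7 = ∑ k ∈ Finset.Ioo 0 7, xc z 0 k * yc z k i := by
  rw [yc, dif_pos h]
  simp [bigCellPoint, hi.ne']

@[simp]
theorem yc_bigCellPoint_of_lt (z : I56 → K) {i j : Fin 8} (hi : 0 < i) (hij : i < j) (hj : j < 7) :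
    yc (bigCellPoint z) i j = yc z i j := by
  simp [yc, bigCellPoint, hi.ne', hj.ne, hij]


set_option maxHeartbeats 4000000 in
theorem vEq_bigCellPoint (z : I56 → K) {i j : Fin 8} (hij : i ≠ j) :
    vEq (bigCellPoint z) i j = 0 := by
  rw [vEq_eq_sum, Fin.sum_univ_eight]
  fin_cases i <;> fin_cases j <;> first | exact absurd rfl hij | skip
  all_goals
    simp only [xc_self, yc_self, xc_bigCellPoint_zero_seven, xc_bigCellPoint_zero,
      xc_bigCellPoint_seven, xc_bigCellPoint_of_lt, yc_bigCellPoint_zero_seven,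
      yc_bigCellPoint_zero, yc_bigCellPoint_seven, yc_bigCellPoint_of_lt, xc_of_gt, yc_of_gt,
      sum_Ioo_zero_seven, sum_Ioo_one_seven, yPfCompl, yPf, Matrix.of_apply, Matrix.cons_val,
      Fin.zero_eta, Fin.mk_one, Fin.reduceFinMk, Fin.reduceLT, Fin.isValue]
    try ring

theorem sum_offDiag_eq_of_symm [CharZero K] (f : Fin 8 → Fin 8 → K) (hf : ∀ i j, f i j = f j i)
    (h0 : ∀ i, f i i = 0) (i : Fin 8) :
    ∑ p : Fin 8 × Fin 8 with p.1 < p.2 ∧ p.1 ≠ i ∧ p.2 ≠ i, f p.1 p.2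
      = 1 / 2 * ∑ j, ∑ k, f j k - ∑ j, f i j := by
  have hlt : ∀ j k, (if j < k ∧ j ≠ i ∧ k ≠ i then f j k else 0) =
      (if j < k then f j k else 0) - (if j = i then if j < k then f j k else 0 else 0)
        - (if k = i then if j < k then f j k else 0 else 0) := by
    intro j k
    grind
  have hswap : ∑ j, ∑ k, f j k = 2 * ∑ j, ∑ k, (if j < k then f j k else 0) := by
    rw [two_mul]
    nth_rewrite 3 [Finset.sum_comm]
    simp only [← Finset.sum_add_distrib]
    refine Finset.sum_congr rfl fun j _ => Finset.sum_congr rfl fun k _ => ?_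
    grind
  have hrow : ∑ j, f i j =
      ∑ k, (if i < k then f i k else 0) + ∑ j, (if j < i then f j i else 0) := by
    rw [← Finset.sum_add_distrib]
    refine Finset.sum_congr rfl fun k _ => ?_
    grind
  rw [Finset.sum_filter, Fintype.sum_prod_type, hswap, hrow]
  simp only [hlt, Finset.sum_sub_distrib, Finset.sum_ite_eq', Finset.mem_univ, if_true]
  rw [Finset.sum_comm (f := fun j k => if j = i then if j < k then f j k else 0 else 0)]
  simp only [Finset.sum_ite_eq', Finset.mem_univ, if_true]
  ring

theorem vDiag_eq [CharZero K] (z : I56 → K) (i : Fin 8) :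
    vDiag z i = 1 / 8 * (∑ j, ∑ k, xc z j k * yc z j k) - ∑ j, xc z i j * yc z i j := by
  rw [vDiag, sum_offDiag_eq_of_symm (fun j k => xc z j k * yc z j k)
    (fun j k => by rw [xc_swap, yc_swap, neg_mul_neg]) (fun j => by rw [xc_self, zero_mul]),
    Finset.sum_subset (Finset.subset_univ (Finset.univ \ {i}))]
  · ring
  · intro k _ hk
    obtain rfl : k = i := by simpa using hk
    rw [xc_self, zero_mul]

set_option maxHeartbeats 4000000 in
theorem sum_mul_bigCellPoint (z : I56 → K) (i : Fin 8) :
    ∑ j, xc (bigCellPoint z) i j * yc (bigCellPoint z) i j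
      = ∑ k ∈ Finset.Ioo 1 7, yc z 1 k * yPfCompl z 1 k := by
  rw [Fin.sum_univ_eight]
  fin_cases i <;>
    simp only [xc_self, yc_self, xc_bigCellPoint_zero_seven, xc_bigCellPoint_zero,
      xc_bigCellPoint_seven, xc_bigCellPoint_of_lt, yc_bigCellPoint_zero_seven,
      yc_bigCellPoint_zero, yc_bigCellPoint_seven, yc_bigCellPoint_of_lt, xc_of_gt, yc_of_gt,
      sum_Ioo_zero_seven, sum_Ioo_one_seven, yPfCompl, yPf, Matrix.of_apply, Matrix.cons_val,
      Fin.zero_eta, Fin.mk_one, Fin.reduceFinMk, Fin.reduceLT, Fin.isValue] <;>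
    ring

theorem vDiag_bigCellPoint [CharZero K] (z : I56 → K) (i : Fin 8) :
    vDiag (bigCellPoint z) i = 0 := by
  simp only [vDiag_eq, sum_mul_bigCellPoint, Finset.sum_const, Finset.card_univ, Fintype.card_fin]
  ring

theorem nodup_of_insert_eq_univ {i j k l a b c d : Fin 8}
    (h : ({i, j, k, l, a, b, c, d} : Finset (Fin 8)) = Finset.univ) :
    [i, j, k, l, a, b, c, d].Nodup := by
  have : [i, j, k, l, a, b, c, d].toFinset = Finset.univ := by simpa using h
  rw [← List.dedup_eq_self]
  refine (List.dedup_sublist _).eq_of_length ?_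
  rw [← List.card_toFinset, this]
  rfl

/-- An increasing quadruple is determined by its complement in `Fin 8`. -/
theorem quadruple_eq_filter {i j k l a b c d : Fin 8} (hab : a < b) (hbc : b < c) (hcd : c < d)
    (h : ({i, j, k, l, a, b, c, d} : Finset (Fin 8)) = Finset.univ) :
    [a, b, c, d] = [0, 1, 2, 3, 4, 5, 6, 7].filter (· ∉ [i, j, k, l]) := by
  have hn := nodup_of_insert_eq_univ h
  have h₁ : [a, b, c, d].Pairwise (· < ·) := by
    simp [hab, hbc, hcd, hab.trans hbc, hbc.trans hcd, hab.trans (hbc.trans hcd)]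
  have h₂ : ([0, 1, 2, 3, 4, 5, 6, 7].filter (· ∉ [i, j, k, l])).Pairwise (· < ·) :=
    List.Pairwise.filter _ (by decide)
  refine List.Perm.eq_of_pairwise (fun _ _ _ _ h h' => absurd h' h.asymm) h₁ h₂
    ((List.perm_ext_iff_of_nodup h₁.nodup h₂.nodup).2 fun m => ?_)
  have hm : m ∈ ({i, j, k, l, a, b, c, d} : Finset (Fin 8)) := h ▸ Finset.mem_univ m
  have h8 : m ∈ ([0, 1, 2, 3, 4, 5, 6, 7] : List (Fin 8)) := by fin_cases m <;> simp
  rw [List.mem_filter]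
  simp only [h8, true_and, decide_eq_true_eq]
  simp only [Finset.mem_insert, Finset.mem_singleton] at hm
  grind

set_option maxHeartbeats 4000000 in
theorem uEq_bigCellPoint (z : I56 → K) {i j k l a b c d : Fin 8} (hij : i < j) (hjk : j < k)
    (hkl : k < l) (hab : a < b) (hbc : b < c) (hcd : c < d)
    (h : ({i, j, k, l, a, b, c, d} : Finset (Fin 8)) = Finset.univ) :
    uEq (bigCellPoint z) i j k l a b c d = 0 := by
  have hm := quadruple_eq_filter hab hbc hcd h
  clear h hab hbc hcd
  unfold uEq
  fin_cases i <;> fin_cases j <;> first | exact absurd hij (by decide) | skip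
  all_goals clear hij; fin_cases k <;> first | exact absurd hjk (by decide) | skip
  all_goals clear hjk; fin_cases l <;> first | exact absurd hkl (by decide) | skip
  all_goals
    clear hkl
    simp at hm
    obtain ⟨rfl, rfl, rfl, rfl⟩ := hm
    simp only [yc_self, xc_bigCellPoint_zero_seven, xc_bigCellPoint_zero,
      xc_bigCellPoint_seven, xc_bigCellPoint_of_lt, yc_bigCellPoint_zero_seven,
      yc_bigCellPoint_zero, yc_bigCellPoint_seven, yc_bigCellPoint_of_lt, yc_of_gt,
      sum_Ioo_zero_seven, sum_Ioo_one_seven, yPfCompl, yPf, Matrix.of_apply, Matrix.cons_val,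
      Fin.zero_eta, Fin.mk_one, Fin.reduceFinMk, Fin.reduceLT, Fin.isValue, Nat.reduceAdd]
    try ring

theorem H7mem_bigCellPoint [CharZero K] (z : I56 → K) : H7mem (bigCellPoint z) :=
  ⟨fun _ _ _ _ _ _ _ _ h₁ h₂ h₃ h₄ h₅ h₆ h => uEq_bigCellPoint z h₁ h₂ h₃ h₄ h₅ h₆ h,
    fun _ _ h => vEq_bigCellPoint z h, vDiag_bigCellPoint z⟩

theorem exists_complement : ∀ i j : Fin 8, 0 < i → i < j → j < 7 → ∃ a b c d : Fin 8,
    a < b ∧ b < c ∧ c < d ∧ ({0, i, j, 7, a, b, c, d} : Finset (Fin 8)) = Finset.univ := by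
  decide +kernel

theorem xc_eq_of_forall_lt {z z' : I56 → K} {i j : Fin 8}
    (h : ∀ i j, i < j → xc z i j = xc z' i j) : xc z i j = xc z' i j := by
  rcases lt_trichotomy i j with hij | rfl | hij
  · exact h i j hij
  · simp only [xc_self]
  · rw [xc_swap z, xc_swap z', h j i hij]

theorem ext_of_xc_yc {z z' : I56 → K} (hx : ∀ i j, i < j → xc z i j = xc z' i j)
    (hy : ∀ i j, i < j → yc z i j = yc z' i j) : z = z' := by
  funext p
  rcases p with ⟨⟨i, j⟩, h⟩ | ⟨⟨i, j⟩, h⟩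
  · simpa only [xc, dif_pos h] using hx i j h
  · simpa only [yc, dif_pos h] using hy i j h

/-- Points of `H₇` with `x^{07} ≠ 0` are determined by the coordinates `x^{0j}`, `x^{i7}` and
`y_{ij}` with `0 < i < j < 7`. -/
theorem H7mem.eq_of_agree [CharZero K] {z z' : I56 → K} (hz : H7mem z) (hz' : H7mem z')
    (h07 : xc z 0 7 ≠ 0) (hη : ∀ i, xc z i 7 = xc z' i 7) (hν : ∀ j, xc z 0 j = xc z' 0 j)
    (hμ : ∀ i j, 0 < i → i < j → j < 7 → yc z i j = yc z' i j) : z = z' := by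
  have hx : ∀ i j, i < j → xc z i j = xc z' i j := by
    intro i j hij
    rcases eq_or_ne i 0 with rfl | hi
    · exact hν j
    rcases eq_or_ne j 7 with rfl | hj
    · exact hη i
    obtain ⟨a, b, c, d, hab, hbc, hcd, h⟩ := exists_complement i j (Fin.pos_iff_ne_zero.2 hi) hij
      (lt_of_le_of_ne (Fin.le_last j) hj)
    have hn := nodup_of_insert_eq_univ h
    have ha : 0 < a := Fin.pos_iff_ne_zero.2 (by grind)
    have hd : d < 7 := lt_of_le_of_ne (Fin.le_last d) (by grind)
    have hu := hz.1 0 i j 7 a b c d (Fin.pos_iff_ne_zero.2 hi) hij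
      (lt_of_le_of_ne (Fin.le_last j) hj) hab hbc hcd h
    have hu' := hz'.1 0 i j 7 a b c d (Fin.pos_iff_ne_zero.2 hi) hij
      (lt_of_le_of_ne (Fin.le_last j) hj) hab hbc hcd h
    have hb := ha.trans hab
    have hc := hcd.trans hd
    rw [uEq, hη, hη, hν, hν, hν, hμ a b ha hab (hbc.trans hc), hμ c d (hb.trans hbc) hcd hd,
      hμ a c ha (hab.trans hbc) hc, hμ b d hb (hbc.trans hcd) hd,
      hμ a d ha (hab.trans (hbc.trans hcd)) hd, hμ b c hb hbc hc] at hu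
    rw [uEq] at hu'
    rw [hη] at h07
    refine mul_left_cancel₀ h07 ?_
    linear_combination hu - hu'
  have hμ' : ∀ i j, 0 < i → i < 7 → 0 < j → j < 7 → yc z i j = yc z' i j := by
    intro i j hi hi' hj hj'
    rcases lt_trichotomy i j with hij | rfl | hij
    · exact hμ i j hi hij hj'
    · simp only [yc_self]
    · rw [yc_swap z, yc_swap z', hμ j i hj hij hi']
  have hx' : ∀ i j, xc z i j = xc z' i j := fun i j => xc_eq_of_forall_lt hx
  have hv : ∀ i j, i ≠ j → ∑ k, xc z i k * (yc z k j - yc z' k j) = 0 := by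
    intro i j hij
    have h := hz.2.1 i j hij
    have h' := hz'.2.1 i j hij
    rw [vEq_eq_sum] at h h'
    simp only [mul_sub, Finset.sum_sub_distrib, h]
    simp only [hx', h', sub_zero]
  have hy7 : ∀ j, 0 < j → j < 7 → yc z 7 j = yc z' 7 j := by
    intro j hj hj'
    have := hv 0 j hj.ne
    rw [Finset.sum_eq_single 7 (fun k _ hk => ?_) (by simp)] at this
    · exact sub_eq_zero.1 ((mul_eq_zero.1 this).resolve_left h07)
    · rcases eq_or_ne k 0 with rfl | h0
      · rw [xc_self, zero_mul]
      · rw [hμ' k j (Fin.pos_iff_ne_zero.2 h0) (lt_of_le_of_ne (Fin.le_last k) hk) hj hj',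
          sub_self, mul_zero]
  have hy0 : ∀ j, 0 < j → j < 7 → yc z 0 j = yc z' 0 j := by
    intro j hj hj'
    have := hv 7 j hj'.ne'
    rw [Finset.sum_eq_single 0 (fun k _ hk => ?_) (by simp), xc_swap, neg_mul, neg_eq_zero] at this
    · exact sub_eq_zero.1 ((mul_eq_zero.1 this).resolve_left h07)
    · rcases eq_or_ne k 7 with rfl | h0
      · rw [xc_self, zero_mul]
      · rw [hμ' k j (Fin.pos_iff_ne_zero.2 hk) (lt_of_le_of_ne (Fin.le_last k) h0) hj hj',
          sub_self, mul_zero]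
  have hy : ∀ i j, i < j → (i, j) ≠ (0, 7) → yc z i j = yc z' i j := by
    intro i j hij hne
    rcases eq_or_ne i 0 with rfl | hi
    · exact hy0 j hij (lt_of_le_of_ne (Fin.le_last j) (by rintro rfl; exact hne rfl))
    have hi' := Fin.pos_iff_ne_zero.2 hi
    rcases eq_or_ne j 7 with rfl | hj
    · rw [yc_swap z, yc_swap z', hy7 i hi' hij]
    · exact hμ i j hi' hij (lt_of_le_of_ne (Fin.le_last j) hj)
  refine ext_of_xc_yc hx fun i j hij => ?_
  by_cases hne : (i, j) = (0, 7)
  · obtain ⟨rfl, rfl⟩ := Prod.mk.inj hne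
    have hd := hz.2.2 0
    have hd' := hz'.2.2 0
    have hrest : ∑ p : Fin 8 × Fin 8 with p.1 < p.2 ∧ p.1 ≠ 0 ∧ p.2 ≠ 0,
        xc z p.1 p.2 * yc z p.1 p.2 = ∑ p : Fin 8 × Fin 8 with p.1 < p.2 ∧ p.1 ≠ 0 ∧ p.2 ≠ 0,
        xc z' p.1 p.2 * yc z' p.1 p.2 := by
      refine Finset.sum_congr rfl fun p hp => ?_
      obtain ⟨-, hlt, h0, -⟩ := Finset.mem_filter.1 hp
      rw [hx', hy p.1 p.2 hlt fun h => h0 (Prod.mk.inj h).1]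
    have hsum : ∑ j ∈ Finset.univ \ {0}, xc z 0 j * (yc z 0 j - yc z' 0 j) = 0 := by
      rw [vDiag, hrest] at hd
      rw [vDiag] at hd'
      simp only [mul_sub, Finset.sum_sub_distrib, hx'] at hd ⊢
      linear_combination (-4 / 3 : K) * (hd - hd')
    rw [Finset.sum_eq_single 7 (fun k hk h7 => ?_) (by simp)] at hsum
    · exact sub_eq_zero.1 ((mul_eq_zero.1 hsum).resolve_left h07)
    · have h0 : k ≠ 0 := by simpa using hk
      rw [hy0 k (Fin.pos_iff_ne_zero.2 h0) (lt_of_le_of_ne (Fin.le_last k) h7), sub_self, mul_zero]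
  · exact hy i j hij hne

/-- The point of `K^56` with the 28 coordinates of `proj28` prescribed and all others zero. -/
def lift28 (w : (Fin 7 → K) × (Q7 → K) × (L7 → K)) : I56 → K
  | Sum.inl p =>
    if h : p.1.2 = 7 then w.1 (p.1.1.castPred ((p.2.trans_eq h).ne))
    else if h' : 0 < p.1.2.castPred h then w.2.2 ⟨p.1.2.castPred h, h'⟩ else 0
  | Sum.inr p =>
    if h : p.1.1 ≠ 0 ∧ p.1.2 ≠ 7 then
      w.2.1 ⟨(p.1.1.castPred (p.2.trans_le (Fin.le_last _)).ne, p.1.2.castPred h.2),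
        Fin.pos_iff_ne_zero.2 fun h0 => h.1 (by simpa using h0), by simpa using p.2⟩
    else 0

theorem proj28_lift28 (w : (Fin 7 → K) × (Q7 → K) × (L7 → K)) : proj28 (lift28 w) = w := by
  obtain ⟨η, μ, ν⟩ := w
  refine Prod.ext (funext fun i => ?_) (Prod.ext (funext fun q => ?_) (funext fun l => ?_))
  · have h : i.castSucc < 7 := Fin.castSucc_lt_last i
    simp [proj28, xc, lift28, h]
  · obtain ⟨⟨j, k⟩, h0, hjk⟩ := q
    have h7 : k.castSucc ≠ 7 := (Fin.castSucc_lt_last k).ne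
    have h0' : j ≠ 0 := h0.ne'
    simp at hjk
    simp [proj28, yc, lift28, hjk, h7, h0']
  · obtain ⟨l, hl⟩ := l
    have h7 : l.castSucc ≠ 7 := (Fin.castSucc_lt_last l).ne
    simp [proj28, xc, lift28, h7, hl]

theorem proj28_smul (c : K) (z : I56 → K) : proj28 (c • z) = c • proj28 z := by
  simp only [proj28, xc_smul, yc_smul]
  rfl

theorem proj28_bigCellPoint {z : I56 → K} (h : xc z 0 7 = 1) :
    proj28 (bigCellPoint z) = proj28 z := by
  refine Prod.ext (funext fun i => ?_) (Prod.ext (funext fun q => ?_) (funext fun l => ?_))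
  · rcases eq_or_ne i 0 with rfl | hi
    · exact (xc_bigCellPoint_zero_seven z).trans h.symm
    · exact xc_bigCellPoint_seven z (Fin.pos_iff_ne_zero.2 (by simpa using hi))
  · exact yc_bigCellPoint_of_lt z q.2.1 q.2.2 (Fin.castSucc_lt_last _)
  · exact xc_bigCellPoint_zero z (Fin.castSucc_lt_last _)

theorem statement7 [IsAlgClosed K] [CharZero K] :
    Set.BijOn (proj28 (K := K))
      {z : I56 → K | H7mem z ∧ ∀ i : Fin 7, xc z i.castSucc 7 ≠ 0}
      {w : (Fin 7 → K) × (Q7 → K) × (L7 → K) | ∀ i : Fin 7, w.1 i ≠ 0} := by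
  refine ⟨fun z hz => hz.2, ?_, ?_⟩
  · rintro z ⟨hz, hne⟩ z' ⟨hz', -⟩ h
    have hη : ∀ i, xc z i 7 = xc z' i 7 := Fin.lastCases
      ((xc_self z 7).trans (xc_self z' 7).symm) fun i => congrFun (congrArg Prod.fst h) i
    refine hz.eq_of_agree hz' (hne 0) hη (fun j => ?_) fun i j hi hij hj => ?_
    · induction j using Fin.lastCases with
      | last => exact hη 0
      | cast l =>
        rcases eq_or_ne l 0 with rfl | hl
        · exact (xc_self z 0).trans (xc_self z' 0).symm
        · exact congrFun (congrArg (fun w => w.2.2) h) ⟨l, Fin.pos_iff_ne_zero.2 hl⟩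
    · exact congrFun (congrArg (fun w => w.2.1) h)
        ⟨(i.castPred (hij.trans hj).ne, j.castPred hj.ne), hi, hij⟩
  · intro w hw
    set θ := w.1 0 with hθ
    have hθ0 : θ ≠ 0 := hw 0
    have h1 : xc (θ⁻¹ • lift28 w) 0 7 = 1 := by
      rw [xc_smul, show xc (lift28 w) 0 7 = θ from congrFun (congrArg Prod.fst (proj28_lift28 w)) 0,
        inv_mul_cancel₀ hθ0]
    have hproj : proj28 (θ • bigCellPoint (θ⁻¹ • lift28 w)) = w := by
      rw [proj28_smul, proj28_bigCellPoint h1, proj28_smul, proj28_lift28, smul_inv_smul₀ hθ0]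
    refine ⟨_, ⟨(H7mem_bigCellPoint _).smul θ, fun i => ?_⟩, hproj⟩
    exact (congrFun (congrArg Prod.fst hproj) i).trans_ne (hw i)
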